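/- Let f_i : ℝ^d → ℝ be convex, differentiable and L_i-smooth, and set f = (1/n) Σ_{i=1}^n f_i. Let a sampling with weights p_C and weights θ^i_C be given, and define β_i := Σ_{C : i∈C} p_C |C| (θ^i_C)², where |C| is the cardinality of C. Then for all x, y ∈ ℝ^d: E_S ‖(1/n) Σ_{i∈S} θ^i_S (∇f_i(x) − ∇f_i(y))‖² ≤ (2/n) max_{i∈[n]} { L_i β_i } · (f(x) − f(y) − ⟨∇f(y), x − y⟩). -/

import Mathlib

open scoped RealInnerProductSpace BigOperators

lemma aux_line {E : Type*} [NormedAddCommGroup E] [InnerProductSpace ℝ E] [CompleteSpace E]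
    (f : E → ℝ) (f' : E → E) (hg : ∀ x, HasGradientAt f (f' x) x) (a h : E) (t : ℝ) :
    HasDerivAt (fun t : ℝ => f (a + t • h)) ⟪f' (a + t • h), h⟫ t := by
  have h1 : HasDerivAt (fun t : ℝ => a + t • h) h t := by
    simpa using ((hasDerivAt_id t).smul_const h).const_add a
  have h2 := (hg (a + t • h)).hasFDerivAt.comp_hasDerivAt t h1
  exact h2.congr_deriv (by simp)

lemma aux_descent {E : Type*} [NormedAddCommGroup E] [InnerProductSpace ℝ E] [CompleteSpace E]
    (f : E → ℝ) (f' : E → E) (hg : ∀ x, HasGradientAt f (f' x) x) (L : ℝ) (hL : 0 ≤ L)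
    (hs : LipschitzWith (Real.toNNReal L) f') (a h : E) :
    f (a + h) ≤ f a + ⟪f' a, h⟫ + L / 2 * ‖h‖ ^ 2 := by
  have hd : ∀ t : ℝ, HasDerivAt
      (fun t : ℝ => f (a + t • h) - t * ⟪f' a, h⟫ - L / 2 * ‖h‖ ^ 2 * t ^ 2)
      (⟪f' (a + t • h), h⟫ - ⟪f' a, h⟫ - L * ‖h‖ ^ 2 * t) t := by
    intro t
    have h3 := ((aux_line f f' hg a h t).sub ((hasDerivAt_id t).mul_const ⟪f' a, h⟫)).sub
      (((hasDerivAt_id t).pow 2).const_mul (L / 2 * ‖h‖ ^ 2))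
    refine h3.congr_deriv ?_
    simp only [id, Nat.cast_ofNat, one_mul, mul_one]
    ring
  have hanti : AntitoneOn
      (fun t : ℝ => f (a + t • h) - t * ⟪f' a, h⟫ - L / 2 * ‖h‖ ^ 2 * t ^ 2) (Set.Ici 0) := by
    apply antitoneOn_of_deriv_nonpos (convex_Ici 0)
    · exact fun t _ => (hd t).continuousAt.continuousWithinAt
    · exact fun t _ => (hd t).differentiableAt.differentiableWithinAt
    · intro t ht
      rw [interior_Ici] at ht
      have ht : 0 < t := ht
      rw [(hd t).deriv, ← inner_sub_left]
      have h1 := real_inner_le_norm (f' (a + t • h) - f' a) h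
      have h2 := hs.dist_le_mul (a + t • h) a
      rw [dist_eq_norm, dist_eq_norm, Real.coe_toNNReal _ hL, add_sub_cancel_left, norm_smul,
        Real.norm_eq_abs, abs_of_pos ht] at h2
      have h3 := mul_le_mul_of_nonneg_right h2 (norm_nonneg h)
      nlinarith
  have := hanti (Set.mem_Ici.2 le_rfl) (Set.mem_Ici.2 zero_le_one) zero_le_one
  simp at this
  linarith

lemma aux_convex {E : Type*} [NormedAddCommGroup E] [InnerProductSpace ℝ E] [CompleteSpace E]
    (f : E → ℝ) (f' : E → E) (hg : ∀ x, HasGradientAt f (f' x) x)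
    (hc : ConvexOn ℝ Set.univ f) (a h : E) :
    f a + ⟪f' a, h⟫ ≤ f (a + h) := by
  have hc' : ConvexOn ℝ Set.univ (fun t : ℝ => f (a + t • h)) := by
    refine ⟨convex_univ, fun s _ t _ u v hu hv huv => ?_⟩
    have := hc.2 (Set.mem_univ (a + s • h)) (Set.mem_univ (a + t • h)) hu hv huv
    convert this using 2
    have : a = (u + v) • a := by rw [huv, one_smul]
    nth_rewrite 1 [this]
    simp only [smul_eq_mul]
    module
  have := hc'.le_slope_of_hasDerivAt (Set.mem_univ 0) (Set.mem_univ 1) zero_lt_one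
    (aux_line f f' hg a h 0)
  simp [slope_def_field] at this
  linarith

lemma aux_coco {E : Type*} [NormedAddCommGroup E] [InnerProductSpace ℝ E] [CompleteSpace E]
    (f : E → ℝ) (f' : E → E) (hg : ∀ x, HasGradientAt f (f' x) x) (L : ℝ) (hL : 0 ≤ L)
    (hs : LipschitzWith (Real.toNNReal L) f')
    (hc : ConvexOn ℝ Set.univ f) (x y : E) :
    ‖f' x - f' y‖ ^ 2 ≤ 2 * L * (f x - f y - ⟪f' y, x - y⟫) := by
  rcases hL.eq_or_lt with h0 | h0
  · have h2 := hs.dist_le_mul x y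
    rw [dist_eq_norm, Real.coe_toNNReal _ hL, ← h0, zero_mul] at h2
    have : ‖f' x - f' y‖ = 0 := le_antisymm h2 (norm_nonneg _)
    rw [this, ← h0]; simp
  · set g := f' x - f' y with hgdef
    have h1 := aux_descent f f' hg L hL hs x (-(L⁻¹ • g))
    have h2 := aux_convex f f' hg hc y (x + (-(L⁻¹ • g)) - y)
    rw [add_sub_cancel] at h2
    have e1 : ⟪f' y, x + (-(L⁻¹ • g)) - y⟫ = ⟪f' y, x - y⟫ - L⁻¹ * ⟪f' y, g⟫ := by
      rw [show x + (-(L⁻¹ • g)) - y = (x - y) - L⁻¹ • g by abel, inner_sub_right,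
        real_inner_smul_right]
    rw [inner_neg_right, real_inner_smul_right, norm_neg, norm_smul, Real.norm_eq_abs,
      abs_of_pos (inv_pos.2 h0)] at h1
    have e2 : ⟪f' x, g⟫ - ⟪f' y, g⟫ = ‖g‖ ^ 2 := by
      rw [← inner_sub_left, ← hgdef, real_inner_self_eq_norm_sq]
    have e3 : L / 2 * (L⁻¹ * ‖g‖) ^ 2 = L⁻¹ / 2 * ‖g‖ ^ 2 := by field_simp
    have e4 : L⁻¹ * ⟪f' x, g⟫ - L⁻¹ * ⟪f' y, g⟫ = L⁻¹ * ‖g‖ ^ 2 := by rw [← e2]; ring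
    have h5 : L⁻¹ / 2 * ‖g‖ ^ 2 ≤ f x - f y - ⟪f' y, x - y⟫ := by linarith
    calc ‖g‖ ^ 2 = 2 * L * (L⁻¹ / 2 * ‖g‖ ^ 2) := by field_simp
      _ ≤ _ := by gcongr

lemma aux_norm_sum {ι E : Type*} [NormedAddCommGroup E] (C : Finset ι) (v : ι → E) :
    ‖∑ i ∈ C, v i‖ ^ 2 ≤ (C.card : ℝ) * ∑ i ∈ C, ‖v i‖ ^ 2 := by
  calc ‖∑ i ∈ C, v i‖ ^ 2 ≤ (∑ i ∈ C, ‖v i‖) ^ 2 := by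
        gcongr; exact norm_sum_le _ _
    _ ≤ _ := sq_sum_le_card_mul_sum_sq

/-- Lemma F.1(ii) of the paper: expected smoothness bound in terms of
`β_i = Σ_{C : i∈C} p_C |C| (θ^i_C)²`. -/
theorem expected_smoothness_beta_bound
    {d n : ℕ} (hn : 0 < n)
    (f : Fin n → EuclideanSpace ℝ (Fin d) → ℝ)
    (f' : Fin n → EuclideanSpace ℝ (Fin d) → EuclideanSpace ℝ (Fin d))
    (hgrad : ∀ i x, HasGradientAt (f i) (f' i x) x)
    (L : Fin n → ℝ) (hL0 : ∀ i, 0 ≤ L i)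
    (hconv : ∀ i, ConvexOn ℝ Set.univ (f i))
    (hsmooth : ∀ i, LipschitzWith (Real.toNNReal (L i)) (f' i))
    (fbar : EuclideanSpace ℝ (Fin d) → ℝ)
    (hfbar : ∀ u, fbar u = (n : ℝ)⁻¹ * ∑ i, f i u)
    (fgrad : EuclideanSpace ℝ (Fin d) → EuclideanSpace ℝ (Fin d))
    (hfgrad : ∀ u, fgrad u = (n : ℝ)⁻¹ • ∑ i, f' i u)
    (pC : Finset (Fin n) → ℝ) (hpC : ∀ C, 0 ≤ pC C) (hpCsum : ∑ C, pC C = 1)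
    (θ : Finset (Fin n) → Fin n → ℝ)
    (β : Fin n → ℝ)
    (hβ : ∀ i, β i = ∑ C ∈ Finset.univ.filter (fun C => i ∈ C),
        pC C * (C.card : ℝ) * (θ C i) ^ 2) :
    ∀ x y : EuclideanSpace ℝ (Fin d),
      ∑ C, pC C * ‖(n : ℝ)⁻¹ • ∑ i ∈ C, θ C i • (f' i x - f' i y)‖ ^ 2
        ≤ 2 / (n : ℝ) *
            (Finset.univ.sup' (Finset.univ_nonempty_iff.mpr (Fin.pos_iff_nonempty.mp hn))
              (fun i => L i * β i))
          * (fbar x - fbar y - ⟪fgrad y, x - y⟫) := by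
  intro x y
  have hn' : (0 : ℝ) < n := by exact_mod_cast hn
  set M := Finset.univ.sup' (Finset.univ_nonempty_iff.mpr (Fin.pos_iff_nonempty.mp hn))
              (fun i => L i * β i) with hM
  have hMi : ∀ i, L i * β i ≤ M := fun i =>
    Finset.le_sup' (fun i => L i * β i) (Finset.mem_univ i)
  have hβ0 : ∀ i, 0 ≤ β i := by
    intro i
    rw [hβ]
    exact Finset.sum_nonneg fun C _ =>
      mul_nonneg (mul_nonneg (hpC C) (Nat.cast_nonneg _)) (sq_nonneg _)
  have hco := fun i => aux_coco (f i) (f' i) (hgrad i) (L i) (hL0 i) (hsmooth i) (hconv i) x y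
  have hD : ∀ i, 0 ≤ f i x - f i y - ⟪f' i y, x - y⟫ := by
    intro i
    have := aux_convex (f i) (f' i) (hgrad i) (hconv i) y (x - y)
    rw [add_sub_cancel] at this
    linarith
  have hB : fbar x - fbar y - ⟪fgrad y, x - y⟫
      = (n : ℝ)⁻¹ * ∑ i, (f i x - f i y - ⟪f' i y, x - y⟫) := by
    rw [hfbar, hfbar, hfgrad, real_inner_smul_left, sum_inner, Finset.sum_sub_distrib,
      Finset.sum_sub_distrib]
    ring
  have hswap : ∑ C, ∑ i ∈ C, pC C * (C.card : ℝ) * (θ C i) ^ 2 * ‖f' i x - f' i y‖ ^ 2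
      = ∑ i, β i * ‖f' i x - f' i y‖ ^ 2 := by
    simp_rw [hβ, Finset.sum_mul]
    apply Finset.sum_comm'
    simp
  calc ∑ C, pC C * ‖(n : ℝ)⁻¹ • ∑ i ∈ C, θ C i • (f' i x - f' i y)‖ ^ 2
      ≤ ∑ C, (n : ℝ)⁻¹ ^ 2 *
          ∑ i ∈ C, pC C * (C.card : ℝ) * (θ C i) ^ 2 * ‖f' i x - f' i y‖ ^ 2 := by
        apply Finset.sum_le_sum
        intro C _
        have h1 := aux_norm_sum C (fun i => θ C i • (f' i x - f' i y))
        have h2 := mul_le_mul_of_nonneg_left h1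
          (mul_nonneg (hpC C) (sq_nonneg ((n : ℝ)⁻¹)))
        rw [norm_smul, mul_pow, Real.norm_eq_abs, sq_abs, ← mul_assoc]
        refine h2.trans (le_of_eq ?_)
        rw [Finset.mul_sum, Finset.mul_sum, Finset.mul_sum]
        refine Finset.sum_congr rfl fun i _ => ?_
        rw [norm_smul, mul_pow, Real.norm_eq_abs, sq_abs]
        ring
    _ = (n : ℝ)⁻¹ ^ 2 * ∑ i, β i * ‖f' i x - f' i y‖ ^ 2 := by
        rw [← Finset.mul_sum, hswap]
    _ ≤ (n : ℝ)⁻¹ ^ 2 * ∑ i, 2 * M * (f i x - f i y - ⟪f' i y, x - y⟫) := by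
        refine mul_le_mul_of_nonneg_left (Finset.sum_le_sum fun i _ => ?_) (sq_nonneg _)
        have h1 := mul_le_mul_of_nonneg_left (hco i) (hβ0 i)
        have h2 := mul_le_mul_of_nonneg_right (hMi i) (hD i)
        linarith
    _ = 2 / (n : ℝ) * M * (fbar x - fbar y - ⟪fgrad y, x - y⟫) := by
        rw [hB, ← Finset.mul_sum]
        ring
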